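/- There is an algorithm that, given integers k ≥ 2 and j ≥ 1 and a DFAO M generating a k-automatic sequence a = (a_n)_{n≥0} over the alphabet {0, 1, …, j−1}, decides whether a avoids all factors of the form x σ(x), where σ is the letter permutation σ(c) = (c+1) mod j applied letterwise to the word x. -/

import Mathlib

/-- Run an encoded DFAO transition table from state `q` on a list of base-`k`
digits, least significant digit first (this is `w^R` for a most-significant-first
representation `w`). -/
def dfaoRun (trans : List (List ℕ)) : ℕ → List ℕ → ℕ
  | q, [] => q
  | q, d :: ds => dfaoRun trans ((trans.getD q []).getD d 0) ds

/-- The encoded DFAO `(trans, q0, out)` over input alphabet `Σ_k = {0,…,k-1}`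
generates the sequence `a`: for every `m` and every base-`k` representation `w`
of `m` (given least significant digit first, possibly with trailing zeros,
all digits `< k`), the output on `w` is `a m`. -/
def dfaoGenerates (k : ℕ) (trans : List (List ℕ)) (q0 : ℕ) (out : List ℕ)
    (a : ℕ → ℕ) : Prop :=
  ∀ (m : ℕ) (w : List ℕ), (∀ d ∈ w, d < k) → Nat.ofDigits k w = m →
    a m = out.getD (dfaoRun trans q0 w) 0

/-- The factor `a_i a_{i+1} ⋯ a_{i+L-1}` of the sequence `a`. -/
def factorAt (a : ℕ → ℕ) (i L : ℕ) : List ℕ :=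
  (List.range L).map fun j => a (i + j)

/-- `w` is a factor of the infinite word `a`. -/
def IsFactorOf (a : ℕ → ℕ) (w : List ℕ) : Prop :=
  ∃ i : ℕ, w = factorAt a i w.length

theorem dfaoRun_eq_foldl (trans : List (List ℕ)) (q : ℕ) (w : List ℕ) :
    dfaoRun trans q w = w.foldl (fun q d => (trans.getD q []).getD d 0) q := by
  induction w generalizing q with
  | nil => rfl
  | cons d w ih => exact ih _

theorem dfaoRun_append (trans : List (List ℕ)) (q : ℕ) (v w : List ℕ) :
    dfaoRun trans q (v ++ w) = dfaoRun trans (dfaoRun trans q v) w := by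
  simp [dfaoRun_eq_foldl]

/-- A bound on all states reachable from `q0`. -/
def dfaoSize (trans : List (List ℕ)) (q0 : ℕ) : ℕ :=
  q0 + trans.flatten.foldr (· + ·) 0 + 1

theorem getD_getD_le_sum_flatten (trans : List (List ℕ)) (q d : ℕ) :
    (trans.getD q []).getD d 0 ≤ trans.flatten.sum := by
  by_cases hq : q < trans.length
  · rw [List.getD_eq_getElem _ _ hq]
    by_cases hd : d < trans[q].length
    · rw [List.getD_eq_getElem _ _ hd]
      exact List.single_le_sum (by simp) _
        (List.mem_flatten.2 ⟨_, List.getElem_mem hq, List.getElem_mem hd⟩)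
    · rw [List.getD_eq_default _ _ (not_lt.1 hd)]
      exact Nat.zero_le _
  · rw [List.getD_eq_default _ _ (not_lt.1 hq)]
    simp

theorem dfaoRun_lt_dfaoSize (trans : List (List ℕ)) (q0 : ℕ) (w : List ℕ) :
    dfaoRun trans q0 w < dfaoSize trans q0 := by
  have key : dfaoRun trans q0 w ≤ q0 + trans.flatten.sum := by
    induction w using List.reverseRecOn with
    | nil => simp [dfaoRun]
    | append_singleton w d _ =>
      rw [dfaoRun_append]
      exact (getD_getD_le_sum_flatten trans _ d).trans (Nat.le_add_left _ _)
  exact Nat.lt_succ_of_le key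

/-- The `l` least significant base-`k` digits of `n`, least significant first. -/
def lowDigits (k l n : ℕ) : List ℕ :=
  (List.range l).map fun s => n / k ^ s % k

theorem lt_of_mem_lowDigits {k : ℕ} (hk : 2 ≤ k) (l n : ℕ) : ∀ d ∈ lowDigits k l n, d < k := by
  intro d hd
  obtain ⟨s, -, rfl⟩ := List.mem_map.1 hd
  exact Nat.mod_lt _ (by omega)

theorem ofDigits_lowDigits (k l n : ℕ) : Nat.ofDigits k (lowDigits k l n) = n % k ^ l := by
  induction l with
  | zero => simp [lowDigits, Nat.mod_one]
  | succ l ih =>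
    have h : lowDigits k (l + 1) n = lowDigits k l n ++ [n / k ^ l % k] := by
      simp [lowDigits, List.range_succ]
    rw [h, Nat.ofDigits_append, ih, Nat.mod_pow_succ]
    simp [lowDigits]

theorem ofDigits_lowDigits_self {k : ℕ} (hk : 2 ≤ k) (n : ℕ) :
    Nat.ofDigits k (lowDigits k n n) = n := by
  rw [ofDigits_lowDigits, Nat.mod_eq_of_lt (Nat.lt_pow_self hk)]

/-- The output of the automaton on the number `n`, started in state `q`. -/
def dfaoEval (k : ℕ) (trans : List (List ℕ)) (q : ℕ) (out : List ℕ) (n : ℕ) : ℕ :=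
  out.getD (dfaoRun trans q (lowDigits k n n)) 0

theorem dfaoGenerates.apply_eq_dfaoEval {k : ℕ} {trans : List (List ℕ)} {q0 : ℕ} {out : List ℕ}
    {a : ℕ → ℕ} (hk : 2 ≤ k) (h : dfaoGenerates k trans q0 out a) (n : ℕ) :
    a n = dfaoEval k trans q0 out n :=
  h n _ (lt_of_mem_lowDigits hk n n) (ofDigits_lowDigits_self hk n)

theorem dfaoGenerates.apply_add_pow_mul {k : ℕ} {trans : List (List ℕ)} {q0 : ℕ} {out : List ℕ}
    {a : ℕ → ℕ} (hk : 2 ≤ k) (h : dfaoGenerates k trans q0 out a) (l n m : ℕ) :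
    a (n + k ^ l * m) =
      dfaoEval k trans (dfaoRun trans q0 (lowDigits k l n)) out (n / k ^ l + m) := by
  rw [dfaoEval, ← dfaoRun_append]
  refine h _ _ ?_ ?_
  · intro d hd
    rcases List.mem_append.1 hd with hd | hd
    · exact lt_of_mem_lowDigits hk _ _ d hd
    · exact lt_of_mem_lowDigits hk _ _ d hd
  · rw [Nat.ofDigits_append, ofDigits_lowDigits, ofDigits_lowDigits_self hk]
    have hl : (lowDigits k l n).length = l := by simp [lowDigits]
    rw [hl, mul_add, ← add_assoc, Nat.mod_add_div]

/-- The factor of length `2 * L` of `a` at position `i` has the form `x σ(x)`, with `x` nonempty. -/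
def ShiftedSquareAt (j : ℕ) (a : ℕ → ℕ) (i L : ℕ) : Prop :=
  0 < L ∧ ∀ t < L, a (i + L + t) = (a (i + t) + 1) % j

theorem forall_not_isFactorOf_iff (j : ℕ) (a : ℕ → ℕ) :
    (∀ x : List ℕ, x ≠ [] → ¬ IsFactorOf a (x ++ x.map fun c => (c + 1) % j)) ↔
      ¬ ∃ i L, ShiftedSquareAt j a i L := by
  rw [← not_iff_not]
  push Not
  constructor
  · rintro ⟨x, hx, i, hi⟩
    refine ⟨i, x.length, List.length_pos_iff.2 hx, fun t ht => ?_⟩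
    have h1 := congrArg (fun l => l[t]?) hi
    have h2 := congrArg (fun l => l[x.length + t]?) hi
    simp [factorAt, ht, Nat.lt_add_right] at h1 h2
    rw [h1] at h2
    rw [h2, add_assoc]
  · rintro ⟨i, L, hL, h⟩
    refine ⟨factorAt a i L, ?_, i, ?_⟩
    · intro h0
      have := congrArg List.length h0
      simp [factorAt] at this
      omega
    · simp only [factorAt, List.length_append, List.length_map, List.length_range, List.map_map,
        List.range_add, List.map_append]
      congr 1
      refine List.map_congr_left fun t ht => ?_
      simp [← h t (List.mem_range.1 ht), add_assoc]

section Pumping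

variable (k : ℕ) (trans : List (List ℕ)) (q0 : ℕ)

/-- What the automaton remembers of the `l` low digits of a position `i`, a length `L` and an
offset `t`: states and carries for `i + t` and `i + L + t`, and how `t` compares to `L`. -/
def digitProfile (l i L t : ℕ) : ℕ × ℕ × ℕ × ℕ × Bool :=
  (dfaoRun trans q0 (lowDigits k l (i + t)), (i + t) / k ^ l,
    dfaoRun trans q0 (lowDigits k l (i + L + t)), (i + L + t) / k ^ l, decide (t < L))

/-- The profiles realized by all offsets with `l` digits, and whether `L` is positive. -/
def digitType (l i L : ℕ) : Finset (ℕ × ℕ × ℕ × ℕ × Bool) × Bool :=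
  ((Finset.range (k ^ l)).image (digitProfile k trans q0 l i L), decide (0 < L))

/-- A finite set containing all digit types. -/
def digitTypes : Finset (Finset (ℕ × ℕ × ℕ × ℕ × Bool) × Bool) :=
  (Finset.range (dfaoSize trans q0) ×ˢ Finset.range 2 ×ˢ Finset.range (dfaoSize trans q0) ×ˢ
    Finset.range 3 ×ˢ Finset.univ).powerset ×ˢ Finset.univ

/-- The number of elements of `digitTypes`. -/
def digitTypeCount : ℕ :=
  2 ^ (dfaoSize trans q0 * (2 * (dfaoSize trans q0 * (3 * 2)))) * 2

theorem card_digitTypes : (digitTypes trans q0).card = digitTypeCount trans q0 := by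
  simp [digitTypes, digitTypeCount]

theorem digitType_mem_digitTypes {l i L : ℕ} (hi : i < k ^ l) (hL : L < k ^ l) :
    digitType k trans q0 l i L ∈ digitTypes trans q0 := by
  have hpos : 0 < k ^ l := by omega
  simp only [digitTypes, digitType, Finset.mem_product, Finset.mem_univ, and_true,
    Finset.mem_powerset]
  intro p hp
  obtain ⟨t, ht, rfl⟩ := Finset.mem_image.1 hp
  have ht := Finset.mem_range.1 ht
  simp only [digitProfile, Finset.mem_product, Finset.mem_range, Finset.mem_univ, and_true,
    dfaoRun_lt_dfaoSize, true_and, Nat.div_lt_iff_lt_mul hpos]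
  omega

variable {k trans q0}

theorem ShiftedSquareAt.of_digitType_eq {j : ℕ} {out : List ℕ} {a : ℕ → ℕ} (hk : 2 ≤ k)
    (h : dfaoGenerates k trans q0 out a) {l i L l' i' L' : ℕ} (hL' : L' < k ^ l')
    (heq : digitType k trans q0 l i L = digitType k trans q0 l' i' L') {m n : ℕ}
    (hs : ShiftedSquareAt j a (i + k ^ l * m) (L + k ^ l * n)) :
    ShiftedSquareAt j a (i' + k ^ l' * m) (L' + k ^ l' * n) := by
  have hpos : 0 < k ^ l := by positivity
  have hpos' : 0 < k ^ l' := by positivity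
  obtain ⟨himg, hzero⟩ := Prod.ext_iff.1 heq
  simp only [digitType, decide_eq_decide] at himg hzero
  refine ⟨?_, fun t ht => ?_⟩
  · by_cases hn : n = 0
    · subst hn
      simpa [← hzero] using hs.1
    · positivity
  · have hmem : digitProfile k trans q0 l' i' L' (t % k ^ l') ∈
        (Finset.range (k ^ l)).image (digitProfile k trans q0 l i L) := by
      rw [himg]
      exact Finset.mem_image_of_mem _ (Finset.mem_range.2 (Nat.mod_lt _ hpos'))
    obtain ⟨s, hsl, hprof⟩ := Finset.mem_image.1 hmem
    have hsl := Finset.mem_range.1 hsl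
    have htdiv := Nat.mod_add_div t (k ^ l')
    have htmod := Nat.mod_lt t hpos'
    generalize t % k ^ l' = t0 at *
    generalize t / k ^ l' = t1 at *
    subst htdiv
    simp only [digitProfile, Prod.mk.injEq, decide_eq_decide] at hprof
    obtain ⟨h1, h2, h3, h4, h5⟩ := hprof
    have hlt : s + k ^ l * t1 < L + k ^ l * n := by
      have hle : t1 ≤ n := by
        by_contra hcon
        have := Nat.mul_le_mul_left (k ^ l') (Nat.succ_le_of_lt (not_le.1 hcon))
        rw [Nat.mul_succ] at this
        omega
      rcases hle.lt_or_eq with hlt | rfl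
      · have := Nat.mul_le_mul_left (k ^ l) (Nat.succ_le_of_lt hlt)
        rw [Nat.mul_succ] at this
        omega
      · have := h5.2 (by omega)
        omega
    have hval := hs.2 _ hlt
    have regroup : ∀ x y z u c : ℕ, x + c * z + (y + c * u) = x + y + c * (z + u) := by
      intros; ring
    simp only [regroup, h.apply_add_pow_mul hk] at hval ⊢
    rw [h1, h2, h3, h4] at hval
    exact hval

theorem ShiftedSquareAt.exists_lt_pow {j : ℕ} {out : List ℕ} {a : ℕ → ℕ} (hk : 2 ≤ k)
    (h : dfaoGenerates k trans q0 out a) {i L : ℕ} (hs : ShiftedSquareAt j a i L) :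
    ∃ i < k ^ digitTypeCount trans q0, ∃ L < k ^ digitTypeCount trans q0,
      ShiftedSquareAt j a i L := by
  obtain ⟨n, hi, hL⟩ : ∃ n, i < k ^ n ∧ L < k ^ n :=
    ⟨i + L, (Nat.le_add_right i L).trans_lt (Nat.lt_pow_self hk),
      (Nat.le_add_left L i).trans_lt (Nat.lt_pow_self hk)⟩
  induction n using Nat.strong_induction_on generalizing i L with
  | _ n ih =>
  by_cases hn : n ≤ digitTypeCount trans q0
  · have := Nat.pow_le_pow_right (by omega : 0 < k) hn
    exact ⟨i, hi.trans_le this, L, hL.trans_le this, hs⟩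
  · have hmod : ∀ x l, x % k ^ l < k ^ l := fun x l => Nat.mod_lt _ (by positivity)
    obtain ⟨l₁, l₂, hlt, hl₂, heq⟩ : ∃ l₁ l₂, l₁ < l₂ ∧ l₂ < n ∧
        digitType k trans q0 l₂ (i % k ^ l₂) (L % k ^ l₂) =
          digitType k trans q0 l₁ (i % k ^ l₁) (L % k ^ l₁) := by
      obtain ⟨l₁, h₁, l₂, h₂, hne, heq⟩ := Finset.exists_ne_map_eq_of_card_lt_of_maps_to
        (s := Finset.range n) (t := digitTypes trans q0)
        (f := fun l => digitType k trans q0 l (i % k ^ l) (L % k ^ l))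
        (by rw [card_digitTypes, Finset.card_range]; omega)
        (fun l _ => digitType_mem_digitTypes k trans q0 (hmod _ _) (hmod _ _))
      rw [Finset.mem_range] at h₁ h₂
      rcases hne.lt_or_gt with hlt | hlt
      · exact ⟨l₁, l₂, hlt, h₂, heq.symm⟩
      · exact ⟨l₂, l₁, hlt, h₁, heq⟩
    have hshort : ∀ x < k ^ n, x % k ^ l₁ + k ^ l₁ * (x / k ^ l₂) < k ^ (l₁ + (n - l₂)) := by
      intro x hx
      have hdiv : x / k ^ l₂ < k ^ (n - l₂) := by
        rw [Nat.div_lt_iff_lt_mul (by positivity), ← pow_add]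
        rwa [Nat.sub_add_cancel hl₂.le]
      have := Nat.mul_le_mul_left (k ^ l₁) (Nat.succ_le_of_lt hdiv)
      rw [Nat.mul_succ, ← pow_add] at this
      have := hmod x l₁
      omega
    rw [← Nat.mod_add_div i (k ^ l₂), ← Nat.mod_add_div L (k ^ l₂)] at hs
    exact ih (l₁ + (n - l₂)) (by omega) (hs.of_digitType_eq hk h (hmod _ _) heq)
      (hshort i hi) (hshort L hL)

end Pumping

section Primrec

variable {α : Type*} [Primcodable α]

theorem PrimrecRel.exists_lt_of_param {R : ℕ → α → Prop} {b : α → ℕ} (hR : PrimrecRel R)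
    (hb : Primrec b) : PrimrecPred fun x => ∃ n < b x, R n x :=
  (PrimrecRel.comp hR.exists_mem_list (Primrec.list_range.comp hb) Primrec.id).of_eq (by simp)

theorem PrimrecRel.forall_lt_of_param {R : ℕ → α → Prop} {b : α → ℕ} (hR : PrimrecRel R)
    (hb : Primrec b) : PrimrecPred fun x => ∀ n < b x, R n x :=
  (PrimrecRel.comp hR.forall_mem_list (Primrec.list_range.comp hb) Primrec.id).of_eq (by simp)

theorem Primrec.nat_pow' : Primrec₂ ((· ^ ·) : ℕ → ℕ → ℕ) :=
  Primrec₂.unpaired'.1 Nat.Primrec.pow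

theorem Primrec.lowDigits {k l n : α → ℕ} (hk : Primrec k) (hl : Primrec l) (hn : Primrec n) :
    Primrec fun x => lowDigits (k x) (l x) (n x) :=
  Primrec.list_map (Primrec.list_range.comp hl) <|
    Primrec.nat_mod.comp
      (Primrec.nat_div.comp (hn.comp Primrec.fst)
        (Primrec.nat_pow'.comp (hk.comp Primrec.fst) Primrec.snd))
      (hk.comp Primrec.fst)

theorem Primrec.dfaoRun {trans : α → List (List ℕ)} {q : α → ℕ} {w : α → List ℕ}
    (ht : Primrec trans) (hq : Primrec q) (hw : Primrec w) :
    Primrec fun x => dfaoRun (trans x) (q x) (w x) := by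
  simp only [dfaoRun_eq_foldl]
  have hstep : Primrec₂ fun (x : α) (p : ℕ × ℕ) => ((trans x).getD p.1 []).getD p.2 0 :=
    (Primrec.list_getD 0).comp
      ((Primrec.list_getD []).comp (ht.comp Primrec.fst) (Primrec.fst.comp Primrec.snd))
      (Primrec.snd.comp Primrec.snd)
  exact Primrec.list_foldl hw hq hstep

theorem Primrec.dfaoEval {k q n : α → ℕ} {trans : α → List (List ℕ)} {out : α → List ℕ}
    (hk : Primrec k) (ht : Primrec trans) (hq : Primrec q) (ho : Primrec out) (hn : Primrec n) :
    Primrec fun x => dfaoEval (k x) (trans x) (q x) (out x) (n x) :=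
  (Primrec.list_getD 0).comp ho (Primrec.dfaoRun ht hq (Primrec.lowDigits hk hn hn))

theorem Primrec.dfaoSize {trans : α → List (List ℕ)} {q : α → ℕ}
    (ht : Primrec trans) (hq : Primrec q) : Primrec fun x => dfaoSize (trans x) (q x) := by
  have hstep : Primrec₂ fun (_ : α) (p : ℕ × ℕ) => p.1 + p.2 :=
    Primrec.nat_add.comp (Primrec.fst.comp Primrec.snd) (Primrec.snd.comp Primrec.snd)
  exact Primrec.succ.comp <| Primrec.nat_add.comp hq <|
    Primrec.list_foldr (Primrec.list_flatten.comp ht) (Primrec.const 0) hstep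

theorem Primrec.digitTypeCount {trans : α → List (List ℕ)} {q : α → ℕ}
    (ht : Primrec trans) (hq : Primrec q) : Primrec fun x => digitTypeCount (trans x) (q x) :=
  Primrec.nat_mul.comp
    (Primrec.nat_pow'.comp (Primrec.const 2) <|
      Primrec.nat_mul.comp (Primrec.dfaoSize ht hq) <|
        Primrec.nat_mul.comp (Primrec.const 2) <|
          Primrec.nat_mul.comp (Primrec.dfaoSize ht hq) (Primrec.const (3 * 2)))
    (Primrec.const 2)

theorem PrimrecPred.shiftedSquareAt {j i L : α → ℕ} {a : α → ℕ → ℕ} (hj : Primrec j)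
    (ha : Primrec₂ a) (hi : Primrec i) (hL : Primrec L) :
    PrimrecPred fun x => ShiftedSquareAt (j x) (a x) (i x) (L x) := by
  have hR : PrimrecRel fun (t : ℕ) (x : α) =>
      a x (i x + L x + t) = (a x (i x + t) + 1) % j x :=
    Primrec.eq.comp
      (ha.comp Primrec.snd <| Primrec.nat_add.comp
        (Primrec.nat_add.comp (hi.comp Primrec.snd) (hL.comp Primrec.snd)) Primrec.fst)
      (Primrec.nat_mod.comp
        (Primrec.succ.comp <| ha.comp Primrec.snd <|
          Primrec.nat_add.comp (hi.comp Primrec.snd) Primrec.fst)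
        (hj.comp Primrec.snd))
  exact (Primrec.nat_lt.comp (Primrec.const 0) hL).and (hR.forall_lt_of_param hL)

theorem PrimrecPred.exists_shiftedSquareAt {j b : α → ℕ} {a : α → ℕ → ℕ} (hj : Primrec j)
    (ha : Primrec₂ a) (hb : Primrec b) :
    PrimrecPred fun x => ∃ i < b x, ∃ L < b x, ShiftedSquareAt (j x) (a x) i L := by
  have hL : PrimrecRel fun (L : ℕ) (y : ℕ × α) =>
      ShiftedSquareAt (j y.2) (a y.2) y.1 L :=
    PrimrecPred.shiftedSquareAt (hj.comp (Primrec.snd.comp Primrec.snd))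
      (ha.comp (Primrec.snd.comp (Primrec.snd.comp Primrec.fst)) Primrec.snd)
      (Primrec.fst.comp Primrec.snd) Primrec.fst
  have hi : PrimrecRel fun (i : ℕ) (x : α) =>
      ∃ L < b x, ShiftedSquareAt (j x) (a x) i L :=
    hL.exists_lt_of_param (hb.comp Primrec.snd)
  exact hi.exists_lt_of_param hb

end Primrec

/-- It is decidable, given `k ≥ 2`, `j ≥ 1`, and a DFAO generating a
`k`-automatic sequence `a` over the alphabet `{0, 1, …, j-1}`, whether `a`
avoids all factors of the form `x σ(x)`, where `σ(c) = (c + 1) mod j` is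
applied letterwise to the nonempty word `x`. -/
theorem avoidsShiftedSquares_decidable :
    ∃ f : ℕ × ℕ × List (List ℕ) × ℕ × List ℕ → Bool,
      Computable f ∧
      ∀ (k j : ℕ) (trans : List (List ℕ)) (q0 : ℕ) (out : List ℕ) (a : ℕ → ℕ),
        2 ≤ k → 1 ≤ j → dfaoGenerates k trans q0 out a → (∀ n : ℕ, a n < j) →
        (f (k, j, trans, q0, out) = true ↔
          ∀ x : List ℕ, x ≠ [] →
            ¬ IsFactorOf a (x ++ x.map fun c => (c + 1) % j)) := by
  have hk : Primrec fun p : ℕ × ℕ × List (List ℕ) × ℕ × List ℕ => p.1 := Primrec.fst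
  have hj : Primrec fun p : ℕ × ℕ × List (List ℕ) × ℕ × List ℕ => p.2.1 :=
    Primrec.fst.comp Primrec.snd
  have ht : Primrec fun p : ℕ × ℕ × List (List ℕ) × ℕ × List ℕ => p.2.2.1 :=
    Primrec.fst.comp (Primrec.snd.comp Primrec.snd)
  have hq : Primrec fun p : ℕ × ℕ × List (List ℕ) × ℕ × List ℕ => p.2.2.2.1 :=
    Primrec.fst.comp (Primrec.snd.comp (Primrec.snd.comp Primrec.snd))
  have ho : Primrec fun p : ℕ × ℕ × List (List ℕ) × ℕ × List ℕ => p.2.2.2.2 :=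
    Primrec.snd.comp (Primrec.snd.comp (Primrec.snd.comp Primrec.snd))
  have ha : Primrec₂ fun (p : ℕ × ℕ × List (List ℕ) × ℕ × List ℕ) (n : ℕ) =>
      dfaoEval p.1 p.2.2.1 p.2.2.2.1 p.2.2.2.2 n :=
    Primrec.dfaoEval (hk.comp Primrec.fst) (ht.comp Primrec.fst) (hq.comp Primrec.fst)
      (ho.comp Primrec.fst) Primrec.snd
  obtain ⟨_, hf⟩ := (PrimrecPred.exists_shiftedSquareAt hj ha
    (Primrec.nat_pow'.comp hk (Primrec.digitTypeCount ht hq))).not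
  refine ⟨_, hf.to_comp, fun k j trans q0 out a hk2 _ hgen _ => ?_⟩
  rw [decide_eq_true_iff, forall_not_isFactorOf_iff, not_iff_not]
  have hae : a = dfaoEval k trans q0 out := funext (hgen.apply_eq_dfaoEval hk2)
  subst hae
  exact ⟨fun ⟨i, _, L, _, h⟩ => ⟨i, L, h⟩, fun ⟨_, _, h⟩ => h.exists_lt_pow hk2 hgen⟩
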